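/- Any Hecke symmetry R on a 3-dimensional vector space V over a field k whose skewsymmetrizer Y = q·Id − R has image equal to Υ² (i.e., the identity of V extends to an isomorphism S(V,R) ≅ S(V)_ζ) commutes with the linear operator (ζ⊗ζ)³, i.e. (ζ⊗ζ)³∘R = R∘(ζ⊗ζ)³. -/

import Mathlib

open TensorProduct LinearMap

noncomputable section

variable (k V : Type) [Field k] [AddCommGroup V] [Module k V]

/-- `R ⊗ Id` acting on `V ⊗ (V ⊗ V)`. -/
def op12 (R : V ⊗[k] V →ₗ[k] V ⊗[k] V) :
    V ⊗[k] (V ⊗[k] V) →ₗ[k] V ⊗[k] (V ⊗[k] V) :=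
  (TensorProduct.assoc k V V V).toLinearMap ∘ₗ LinearMap.rTensor V R ∘ₗ
    (TensorProduct.assoc k V V V).symm.toLinearMap

/-- `Id ⊗ R` acting on `V ⊗ (V ⊗ V)`. -/
def op23 (R : V ⊗[k] V →ₗ[k] V ⊗[k] V) :
    V ⊗[k] (V ⊗[k] V) →ₗ[k] V ⊗[k] (V ⊗[k] V) :=
  LinearMap.lTensor V R

/-- A Hecke symmetry with parameter `q`: an operator on `V ⊗ V` satisfying the braid
equation and the Hecke relation `(R - q·Id)(R + Id) = 0`, with `q ≠ 0`. -/
def IsHeckeSymmetry (q : k) (R : V ⊗[k] V →ₗ[k] V ⊗[k] V) : Prop :=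
  q ≠ 0 ∧
    op12 k V R ∘ₗ op23 k V R ∘ₗ op12 k V R = op23 k V R ∘ₗ op12 k V R ∘ₗ op23 k V R ∧
    (R - q • LinearMap.id) ∘ₗ (R + LinearMap.id) = 0

/-- `x ⋏ y = ζ(x) ⊗ y - ζ(y) ⊗ x`. -/
def wedge2 (ζ : V ≃ₗ[k] V) (x y : V) : V ⊗[k] V := ζ x ⊗ₜ[k] y - ζ y ⊗ₜ[k] x

/-- `Υ²`, the span of the tensors `x ⋏ y`. -/
def Ups2 (ζ : V ≃ₗ[k] V) : Submodule k (V ⊗[k] V) :=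
  Submodule.span k {w : V ⊗[k] V | ∃ x y : V, w = wedge2 k V ζ x y}

/-- `x ⋏ y ⋏ z`. -/
def wedge3 (ζ : V ≃ₗ[k] V) (x y z : V) : V ⊗[k] (V ⊗[k] V) :=
  ζ (ζ x) ⊗ₜ[k] (ζ y ⊗ₜ[k] z) + ζ (ζ y) ⊗ₜ[k] (ζ z ⊗ₜ[k] x) + ζ (ζ z) ⊗ₜ[k] (ζ x ⊗ₜ[k] y)
    - ζ (ζ x) ⊗ₜ[k] (ζ z ⊗ₜ[k] y) - ζ (ζ y) ⊗ₜ[k] (ζ x ⊗ₜ[k] z) - ζ (ζ z) ⊗ₜ[k] (ζ y ⊗ₜ[k] x)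

/-- `Υ³`, the span of the tensors `x ⋏ y ⋏ z` (which coincides with
`(V ⊗ Υ²) ∩ (Υ² ⊗ V)`). -/
def Ups3 (ζ : V ≃ₗ[k] V) : Submodule k (V ⊗[k] (V ⊗[k] V)) :=
  Submodule.span k {t : V ⊗[k] (V ⊗[k] V) | ∃ x y z : V, t = wedge3 k V ζ x y z}

/-- The bilinear extension `w ↦ x ⋏ w` of the wedge multiplication `V × Υ² → Υ³`:
on elements of `Υ²` it satisfies `x ⋏ (y ⋏ z) = x ⋏ y ⋏ z`. -/
def wedge31 (ζ : V ≃ₗ[k] V) (x : V) : V ⊗[k] V →ₗ[k] V ⊗[k] (V ⊗[k] V) :=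
  TensorProduct.mk k V (V ⊗[k] V) (ζ (ζ x)) +
    (TensorProduct.assoc k V V V).toLinearMap ∘ₗ
      ((TensorProduct.mk k (V ⊗[k] V) V).flip x ∘ₗ
        TensorProduct.map ζ.toLinearMap ζ.toLinearMap) -
    TensorProduct.map ζ.toLinearMap (TensorProduct.mk k V V (ζ x))

/-- The skewsymmetrizer `Y = q·Id - R`. -/
def skewY (q : k) (R : V ⊗[k] V →ₗ[k] V ⊗[k] V) : V ⊗[k] V →ₗ[k] V ⊗[k] V :=
  q • LinearMap.id - R

/-- `R' = (ζ⁻¹ ⊗ ζ⁻¹) ∘ R ∘ (ζ ⊗ ζ)`. -/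
def Rprime (ζ : V ≃ₗ[k] V) (R : V ⊗[k] V →ₗ[k] V ⊗[k] V) :
    V ⊗[k] V →ₗ[k] V ⊗[k] V :=
  TensorProduct.map ζ.symm.toLinearMap ζ.symm.toLinearMap ∘ₗ R ∘ₗ
    TensorProduct.map ζ.toLinearMap ζ.toLinearMap

/-- `ℓ_{xy}(z) = ω̃(x ⋏ Y(ζ(y) ⊗ z))`, where `Ω` is a linear extension of `ω̃` to
`V ⊗ V ⊗ V`. -/
def ell (ζ : V ≃ₗ[k] V) (Y : V ⊗[k] V →ₗ[k] V ⊗[k] V)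
    (Ω : V ⊗[k] (V ⊗[k] V) →ₗ[k] k) (x y : V) : Module.Dual k V :=
  Ω ∘ₗ wedge31 k V ζ x ∘ₗ Y ∘ₗ TensorProduct.mk k V V (ζ y)

/-- The linear forms `ℓ_{xy}` associated with the Hecke symmetry `R`. -/
def ellF (ζ : V ≃ₗ[k] V) (q : k) (R : V ⊗[k] V →ₗ[k] V ⊗[k] V)
    (Ω : V ⊗[k] (V ⊗[k] V) →ₗ[k] k) (x y : V) : Module.Dual k V :=
  ell k V ζ (skewY k V q R) Ω x y

/-- The linear forms `ℓ'_{xy}` associated with the twisted Hecke symmetry `R'`. -/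
def ellF' (ζ : V ≃ₗ[k] V) (q : k) (R : V ⊗[k] V →ₗ[k] V ⊗[k] V)
    (Ω : V ⊗[k] (V ⊗[k] V) →ₗ[k] k) (x y : V) : Module.Dual k V :=
  ell k V ζ (skewY k V q (Rprime k V ζ R)) Ω x y

namespace TwistedHecke

/-- The determinant of three vectors of `K³`. -/
def vol {K : Type*} [Field K] (x y z : Fin 3 → K) : K :=
  x 0 * (y 1 * z 2 - y 2 * z 1) + x 1 * (y 2 * z 0 - y 0 * z 2) + x 2 * (y 0 * z 1 - y 1 * z 0)

/-- The identities satisfied by the structure forms of a Hecke symmetry with image `Υ²`. -/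
structure VPair {K : Type*} [Field K] (q : K)
    (F H : (Fin 3 → K) →ₗ[K] (Fin 3 → K) →ₗ[K] (Fin 3 → K) →ₗ[K] K)
    (ν μ : (Fin 3 → K) →ₗ[K] (Fin 3 → K)) : Prop where
  ne : q ≠ 0
  skewF : ∀ x y z, F x y z - F x z y = (1 + q) * vol x y z
  skewH : ∀ x y z, H x y z - H x z y = (1 + q) * vol x y z
  eqI : ∀ p r x y u v, H p x u * F y r v - H p x v * F y r u - H r x u * F y p v
    + H r x v * F y p u = q * vol x r p * vol y u v + vol y r p * vol (ν x) u v
  eqII : ∀ c x y z u v, F u y z * H c x v - F v y z * H c x u - F u x z * H c y v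
    + F v x z * H c y u = q * vol c x y * vol z u v + vol (μ z) x y * vol c u v
  eqIII : ∀ x y z, F (ν x) y z = H (μ z) x y

namespace VPair
variable {K : Type*} [Field K] {q : K}
    {F H : (Fin 3 → K) →ₗ[K] (Fin 3 → K) →ₗ[K] (Fin 3 → K) →ₗ[K] K}
    {ν μ : (Fin 3 → K) →ₗ[K] (Fin 3 → K)}

theorem vol_cyc (x y z : Fin 3 → K) : vol y z x = vol x y z := by unfold vol; ring
@[simp] theorem vol_self₁ (x y : Fin 3 → K) : vol x x y = 0 := by unfold vol; ring
@[simp] theorem vol_self₂ (x y : Fin 3 → K) : vol x y x = 0 := by unfold vol; ring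
@[simp] theorem vol_self₃ (x y : Fin 3 → K) : vol y x x = 0 := by unfold vol; ring

theorem cramer (e u w x : Fin 3 → K) (h : vol e u w = 1) :
    x = vol x u w • e + vol e x w • u + vol e u x • w := by
  have : x = vol e u w • x := by rw [h, one_smul]
  rw [this]; simp only [h, one_smul]
  conv_lhs => rw [this]
  funext i
  simp only [vol, Pi.add_apply, Pi.smul_apply, smul_eq_mul]
  fin_cases i <;> simp <;> ring

theorem exists_adapted (f : (Fin 3 → K) →ₗ[K] K) (e : Fin 3 → K) (h : f e ≠ 0) :
    ∃ u w, f u = 0 ∧ f w = 0 ∧ vol e u w = 1 := by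
  have key : ∀ a b : Fin 3 → K, vol e a b ≠ 0 → ∃ u w, f u = 0 ∧ f w = 0 ∧ vol e u w = 1 := by
    intro a b hab
    refine ⟨(vol e a b)⁻¹ • (a - (f a / f e) • e), b - (f b / f e) • e, ?_, ?_, ?_⟩
    · simp; right; field_simp; simp
    · simp; field_simp; simp
    · have : vol e ((vol e a b)⁻¹ • (a - (f a / f e) • e)) (b - (f b / f e) • e)
          = (vol e a b)⁻¹ * vol e a b := by
        generalize (vol e a b)⁻¹ = d
        simp only [vol, Pi.sub_apply, Pi.smul_apply, smul_eq_mul]; ring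
      rw [this, inv_mul_cancel₀ hab]
  by_contra hc
  apply h
  have h0 : ∀ a b : Fin 3 → K, vol e a b = 0 := fun a b => by
    by_contra hab; exact hc (key a b hab)
  have : e = 0 := by
    have h1 := h0 (Pi.single 1 1) (Pi.single 2 1)
    have h2 := h0 (Pi.single 2 1) (Pi.single 0 1)
    have h3 := h0 (Pi.single 0 1) (Pi.single 1 1)
    simp [vol] at h1 h2 h3
    funext i; fin_cases i <;> simp [h1, h2, h3]
  simp [this]

theorem ext_adapted {M : Type*} [AddCommGroup M] [Module K M] {e u w : Fin 3 → K}
    (h : vol e u w = 1) {f g : (Fin 3 → K) →ₗ[K] M} (he : f e = g e) (hu : f u = g u)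
    (hw : f w = g w) : f = g := by
  refine LinearMap.ext fun x => ?_
  rw [cramer e u w x h]
  simp only [map_add, map_smul, he, hu, hw]

theorem det_ne {K : Type*} [Field K] {q p11 p12 p21 p22 s11 s12 s21 s22 : K} (hq : q ≠ 0)
  (a2 : s11 * p22 - s12 * p21 = q)
  (a3 : s21 * p12 - s22 * p11 = q * -1) (a4 : s21 * p22 - s22 * p21 = 0) :
   p11 * p22 - p12 * p21 ≠ 0 := by
  intro hd
  have h1 : q * p21 = 0 := by linear_combination p21 * a3 - p11 * a4 + s21 * hd
  have h2 : q * p22 = 0 := by linear_combination p22 * a3 - p12 * a4 + s22 * hd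
  exact mul_ne_zero hq hq (by linear_combination (-q) * a2 + s11 * h2 - s12 * h1)

theorem ratio_eq {K : Type*} [Field K] {b ρ t q p11 p12 p21 p22 Q11 Q21 Q22 : K} (hq : q ≠ 0)
  (hb : b * (p11 * p22 - p12 * p21) = q) (ht : b * t = t) (p0 : p12 = p21 + t)
  (h1 : b * p11 = - ρ * Q11) (h2 : b * p12 = - ρ * (Q21 - t)) (h4 : b * p22 = - ρ * Q22)
  (E1 : p11 * (p11 + Q11) = 0) (E2 : p22 * (p22 + Q22) = 0)
  (E3 : p21*(-ρ * p12) + Q21*(-ρ * p12+t) = q + Q11 * (b * p22) - Q21 * (b * p21)) : b = ρ := by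
  by_contra hne
  have hne : b - ρ ≠ 0 := sub_ne_zero.2 hne
  have z1 : p11 = 0 := by
    have : (b - ρ) * p11 ^ 2 = 0 := by linear_combination p11 * h1 - ρ * E1
    simpa [hne] using this
  have z2 : p22 = 0 := by
    have : (b - ρ) * p22 ^ 2 = 0 := by linear_combination p22 * h4 - ρ * E2
    simpa [hne] using this
  subst z1 z2
  have hp : p12 ≠ 0 := by rintro rfl; exact hq (by linear_combination -hb)
  have : (b - ρ) * p12 * (p21 + Q21) = 0 := by
    linear_combination E3 + Q21 * b * p0 - hb + Q21 * ht
  have : p21 + Q21 = 0 := by simpa [hne, hp] using this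
  have : (b - ρ) * p12 = 0 := by linear_combination h2 - ρ * p0 - ρ * this
  simp [hne, hp] at this

set_option maxHeartbeats 1600000 in
theorem eq_of_ne (P : VPair q F H ν μ) (e : Fin 3 → K) (hφ : F e e e ≠ 0) : F = H := by
  obtain ⟨u, w, fu, fw, v0⟩ := exists_adapted (F e e) e hφ
  have v1 : vol u w e = 1 := by rw [← v0]; unfold vol; ring
  have v2 : vol w e u = 1 := by rw [← v0]; unfold vol; ring
  have v3 : vol e w u = -1 := by rw [← v0]; unfold vol; ring
  have v4 : vol w u e = -1 := by rw [← v0]; unfold vol; ring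
  have v5 : vol u e w = -1 := by rw [← v0]; unfold vol; ring
  obtain ⟨hq, sF, sH, I, II, III⟩ := P
  have fu' : F e u e = 0 := by have := sF e u e; simp_all
  have fw' : F e w e = 0 := by have := sF e w e; simp_all
  have sHe (x : Fin 3 → K) : H e x e = H e e x := by
    have := sH e x e; simpa [sub_eq_zero] using this
  have p0 : F e u w = F e w u + (1 + q) := by
    have := sF e u w; simp only [v0] at this; linear_combination this
  have s0 : H e u w = H e w u + (1 + q) := by
    have := sH e u w; simp only [v0] at this; linear_combination this
  -- `P_H J Pᵀ = q J`
  have a1 := I e u u e u w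
  have a2 := I e w u e u w
  have a3 := I e u w e u w
  have a4 := I e w w e u w
  simp only [fu, fw, v0, v1, v4, vol_self₁, vol_self₂, mul_zero, zero_mul, add_zero, sub_zero,
    mul_one] at a1 a2 a3 a4
  -- vanishing of `h` on the plane
  have i1 := I e u u e e u
  have i2 := I e u u e e w
  have i3 := I e u w e e u
  have i4 := I e u w e e w
  have i5 := I e w u e e u
  have i6 := I e w u e e w
  have i7 := I e w w e e u
  have i8 := I e w w e e w
  have z1 := sH u u w
  have z2 := sH w u w
  simp only [fu, fw, fu', fw', sHe, v1, v4, vol_self₁, vol_self₂, mul_zero, zero_mul, add_zero,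
    sub_zero, mul_one] at i1 i2 i3 i4 i5 i6 i7 i8 z1 z2
  have c1 : H e e u * F e u w = H e e w * F e u u := by linear_combination i2 - i3 - F e e e * z1
  have hu : H e e u = 0 := by grind
  have hw : H e e w = 0 := by grind
  simp only [hu, hw, zero_mul, zero_add, mul_eq_zero, hφ, or_false] at i1 i2 i3 i4 i5 i6 i7 i8
  clear z1 z2 c1
  -- proportionality of the two planar forms
  have hd : F e u u * F e w w - F e u w * F e w u ≠ 0 := by
    exact det_ne hq a2 a3 a4
  obtain ⟨b, hb⟩ : ∃ b, b * (F e u u * F e w w - F e u w * F e w u) = q := ⟨q / _,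
    div_mul_cancel₀ _ hd⟩
  have b1 : H e u u = b * F e u u := by
    refine mul_right_cancel₀ hd ?_
    linear_combination  F e u u * a2 - F e w u * a1 - F e u u * hb
  have b2 : H e u w = b * F e u w := by
    refine mul_right_cancel₀ hd ?_
    linear_combination  F e u w * a2 - F e w w * a1 - F e u w * hb
  have b3 : H e w u = b * F e w u := by
    refine mul_right_cancel₀ hd ?_
    linear_combination  F e u u * a4 - F e w u * a3 - F e w u * hb
  have b4 : H e w w = b * F e w w := by
    refine mul_right_cancel₀ hd ?_
    linear_combination  F e u w * a4 - F e w w * a3 - F e w w * hb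
  have hbt : b * (1 + q) = 1 + q := by
    linear_combination s0 - b2 + b3 - b * p0
  have d1 := II e u e e e u
  have d2 := II e u e e e w
  have d3 := II e w e e e u
  have d4 := II e w e e e w
  have m1 := I e u e e e u
  have m2 := I e u e e e w
  have m3 := I e w e e e u
  have m4 := I e w e e e w
  simp only [fu, fw, fu', fw', hu, hw, sHe, vol_self₁, vol_self₂, mul_zero, zero_mul, add_zero,
    sub_zero] at d1 d2 d3 d4 m1 m2 m3 m4
  obtain ⟨ρ, hρ⟩ : ∃ ρ, ρ * F e e e = H e e e := ⟨_ / _, div_mul_cancel₀ _ hφ⟩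
  have hη : H e e e ≠ 0 := by
    intro h
    have z1 : H e u u = 0 := by simpa [h, hφ] using d1
    have z2 : H e u w = 0 := by simpa [h, hφ] using d2
    exact hq (by rw [← a2, z1, z2]; ring)
  have hρ0 : ρ ≠ 0 := by rintro rfl; exact hη (by rw [← hρ, zero_mul])
  have d1 : H e u u = - ρ * F u u e := mul_left_cancel₀ hφ (by linear_combination d1 + F u u e * hρ)
  have d2 : H e u w = - ρ * F w u e := mul_left_cancel₀ hφ (by linear_combination d2 + F w u e * hρ)
  have d3 : H e w u = - ρ * F u w e := mul_left_cancel₀ hφ (by linear_combination d3 + F u w e * hρ)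
  have d4 : H e w w = - ρ * F w w e := mul_left_cancel₀ hφ (by linear_combination d4 + F w w e * hρ)
  have m1 : H u e u = - ρ * F e u u := mul_left_cancel₀ hφ (by linear_combination m1 + F e u u * hρ)
  have m2 : H u e w = - ρ * F e u w := mul_left_cancel₀ hφ (by linear_combination m2 + F e u w * hρ)
  have m3 : H w e u = - ρ * F e w u := mul_left_cancel₀ hφ (by linear_combination m3 + F e w u * hρ)
  have m4 : H w e w = - ρ * F e w w := mul_left_cancel₀ hφ (by linear_combination m4 + F e w w * hρ)
  have e1 := II e u e u e u
  have e2 := II e u e u e w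
  have e3 := II e u e w e u
  have e4 := II e u e w e w
  have e5 := II e w e u e u
  have e6 := II e w e u e w
  have e7 := II e w e w e u
  have e8 := II e w e w e w
  simp only [fu, fw, hu, hw, sHe, v2, v5, vol_self₁, vol_self₂, mul_zero, zero_mul, add_zero,
    sub_zero, zero_add, mul_one, mul_eq_zero, hη, or_false] at e1 e2 e3 e4 e5 e6 e7 e8
  have q1 := sF u e u
  have q2 := sF u e w
  have q3 := sF w e u
  have q4 := sF w e w
  have n1 := sH u e u
  have n2 := sH u e w
  have n3 := sH w e u
  have n4 := sH w e w
  simp only [v2, v5, vol_self₂, mul_zero, mul_one] at q1 q2 q3 q4 n1 n2 n3 n4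
  -- elimination of `μ`
  have t1 := II e e u u u w
  have t2 := II e e w u u w
  have t3 := II e e u w u w
  have t4 := II e e w w u w
  simp only [hu, hw, v0, vol_self₁, vol_self₂, mul_zero, sub_zero, zero_sub, zero_add, mul_one]
    at t1 t2 t3 t4
  have E1 := II u e u u e u
  have E2 := II w e w w e w
  have E3 := II u e w u e w
  simp only [fu, fw, v5, vol_self₂, mul_zero, zero_mul, add_zero, sub_zero, ← t1,
    ← t2, ← t4] at E1 E2 E3
  have hbρ : b = ρ := by
    refine ratio_eq (t := 1 + q) (Q11 := F u e u) (Q21 := F w e u) (Q22 := F w e w)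
        hq hb hbt p0 ?_ ?_ ?_ ?_ ?_ ?_
    · linear_combination d1 - b1 + ρ * q1
    · linear_combination d2 - b2 + ρ * q3
    · linear_combination d4 - b4 + ρ * q4
    · refine (mul_eq_zero.1 (?_ : ρ * _ = 0)).resolve_left hρ0
      linear_combination -E1 + F e u u * m1 + F u e u * (m1 - n1) - e1 * H u e e
    · refine (mul_eq_zero.1 (?_ : ρ * _ = 0)).resolve_left hρ0
      linear_combination -E2 + F e w w * m4 + F w e w * (m4 - n4) - e8 * H w e e
    · linear_combination E3 - F e w u * m2 - F w e u * (m2 - n2) + e6 * H u e e + F u e u * b4 -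
      F w e u * b3
  subst hbρ
  have Q1 : F u u e = - F e u u := mul_left_cancel₀ hρ0 (by linear_combination d1 - b1)
  have Q2 : F w u e = - F e u w := mul_left_cancel₀ hρ0 (by linear_combination d2 - b2)
  have Q3 : F u w e = - F e w u := mul_left_cancel₀ hρ0 (by linear_combination d3 - b3)
  have Q4 : F w w e = - F e w w := mul_left_cancel₀ hρ0 (by linear_combination d4 - b4)
  have s1 := II e e u e u w
  have s2 := II e e w e u w
  have r1 := II u e u e e u
  have r2 := II u e u e e w
  have r5 := II w e u e e u
  have r6 := II w e u e e w
  simp only [hu, hw, v0, vol_self₁, mul_zero, sub_zero, zero_sub, zero_add, mul_one, Q1, Q2, Q3,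
    Q4] at s1 s2
  simp only [fu', v2, v5, vol_self₁, vol_self₂, mul_zero, zero_mul, add_zero, sub_zero,
    zero_sub, zero_add, mul_one, Q1, Q2, i1, i2, i5, i6, ← s1]
    at r1 r2 r5 r6
  have y1 : H u u e = - b * F e u u := by linear_combination m1 - n1
  have y2 : H u w e = - b * F e w u := by linear_combination m2 - n2 - b * p0 - hbt
  have y3 : H w u e = - b * F e u w := by linear_combination m3 - n3 + b * p0 + hbt
  have y4 : H w w e = - b * F e w w := by linear_combination m4 - n4
  have hu' : H u e e = b * F u e e := by
    refine mul_right_cancel₀ hd ?_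
    linear_combination F e w w * (r1 - F u e e * y1) - F e w u * (r2 - F w e e * y1 +
      F u e e * b2 - F w e e * b1)
  have hw' : H w e e = b * F w e e := by
    refine mul_right_cancel₀ hd ?_
    linear_combination F e w w * (r5 - F u e e * y3 - F u e e * b2 +
      F w e e * b1) - F e w u * (r6 - F w e e * y3)
  clear s1 s2 r1 r2 r5 r6
  have hb1 : b = 1 := by
    by_cases ht : 1 + q = 0
    · have g1 := III e u u
      have g2 := III e w u
      have A1 := I u w e e u w
      rw [cramer e u w (ν e) v0, cramer e u w (μ u) v0] at g1 g2
      have c1 (x : Fin 3 → K) : vol x e u = vol e u x := by unfold vol; ring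
      have c2 (x : Fin 3 → K) : vol x e w = - vol e x w := by unfold vol; ring
      rw [c1] at t1
      rw [c2] at t2
      simp only [map_add, map_smul, LinearMap.add_apply, LinearMap.smul_apply, smul_eq_mul, e1, e2,
        e5, e6, hu, hw] at g1 g2
      simp only [v0, v3] at A1
      have x1 : F u e u = - F e u u := by linear_combination q1 + Q1
      have x2 : F u e w = - F e u w := by linear_combination q2 + Q3 + p0
      have x3 : F w e u = - F e u w := by linear_combination q3 + Q2 + ht
      have x4 : F w e w = - F e w w := by linear_combination q4 + Q4
      have p0' : F e w u = F e u w := by linear_combination -p0 - ht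
      rw [p0'] at hb b3 m3 A1 g2
      have α : vol (ν e) u w = -1 := by
        rw [m1, m2, m3, m4] at A1
        linear_combination A1 + 2 * hb + ht
      have γ : vol e u (μ u) = 0 := by rw [← t1, x1, x3, b1, b2]; ring
      have β : vol e (μ u) w = 1 := by
        rw [x1, x3, b3, b4] at t2; linear_combination t2 - hb - ht
      rw [α, β, γ, m1] at g1
      rw [α, β, γ, m2] at g2
      refine mul_right_cancel₀ hq ?_
      rw [← hb]
      linear_combination b * F e w w * g1 - b * F e u w * g2
    · exact mul_right_cancel₀ ht (by rw [hbt, one_mul])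
  subst hb1
  refine ext_adapted v0 (ext_adapted v0 ?_ ?_ ?_) (ext_adapted v0 ?_ ?_ ?_) (ext_adapted v0 ?_ ?_
    ?_) <;> refine ext_adapted v0 ?_ ?_ ?_
  all_goals clear I II III sF sH t1 t2 t3 t4 E1 E2 E3 a1 a2 a3 a4
  all_goals grind

theorem eq_zero_of_vol {e : Fin 3 → K} (h0 : ∀ a b : Fin 3 → K, vol e a b = 0) : e = 0 := by
  have h1 := h0 (Pi.single 1 1) (Pi.single 2 1)
  have h2 := h0 (Pi.single 2 1) (Pi.single 0 1)
  have h3 := h0 (Pi.single 0 1) (Pi.single 1 1)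
  simp [vol] at h1 h2 h3
  funext i; fin_cases i <;> simp [h1, h2, h3]

theorem diag_eq_zero (P : VPair q F H ν μ) (hF : ∀ e, F e e e = 0) (e : Fin 3 → K) :
    H e e e = 0 := by
  by_contra hη
  obtain ⟨r, w, hr, hw, hv, fw⟩ : ∃ r w, H e e r = 0 ∧ H e e w = 0 ∧ vol e r w ≠ 0 ∧ F e e w = 0
    := by
    obtain ⟨a, b, ha, hb, hab⟩ := exists_adapted (H e e) e hη
    by_cases h : F e e b = 0
    · exact ⟨a, b, ha, hb, by simp [hab], h⟩
    · refine ⟨b, F e e b • a - F e e a • b, hb, by simp [ha, hb], ?_, ?_⟩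
      · have : vol e b (F e e b • a - F e e a • b) = - F e e b * vol e a b := by
          simp only [vol, Pi.sub_apply, Pi.smul_apply, smul_eq_mul]; ring
        simpa [this, hab] using h
      · simp [mul_comm]
  have fe := hF e
  obtain ⟨hq, sF, sH, I, II, III⟩ := P
  have sFe (x : Fin 3 → K) : F e x e = F e e x := by
    have := sF e x e; simpa [sub_eq_zero] using this
  have sHe (x : Fin 3 → K) : H e x e = H e e x := by
    have := sH e x e; simpa [sub_eq_zero] using this
  have a1 := II e r e e e w
  have a2 := II e w e e e w
  have b1 := I e r r e e w
  have b2 := I e r w e e w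
  have c1 := II e r e r e w
  have c2 := II e w e r e w
  have d := I w r e w e r
  simp only [fe, hr, hw, fw, sFe, sHe, vol_self₁, vol_self₂, mul_zero, zero_mul, add_zero,
    sub_zero] at a1 a2 b1 b2 c1 c2 d
  have x1 : F w r e = 0 := by simpa [hη] using a1
  have x2 : F w w e = 0 := by simpa [hη] using a2
  have x3 : F w r r = 0 := mul_right_cancel₀ hη (by linear_combination c1 + b1)
  have x4 : F w w r = 0 := mul_right_cancel₀ hη (by linear_combination c2 + b2)
  have hv' : vol w e r = vol e r w := vol_cyc w e r ▸ rfl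
  rw [x1, x2, x3, x4, hv'] at d
  exact mul_ne_zero (mul_ne_zero hq hv) hv (by linear_combination -d)

/-- A cubic form vanishing identically over a field with more than two elements has vanishing
partial polarization. -/
theorem polar (hF : ∀ e, F e e e = 0) (hK : ∃ c : K, c ≠ 0 ∧ c ≠ 1) (r y : Fin 3 → K) :
    F r y y + F y r y + F y y r = 0 := by
  obtain ⟨c, h0, h1⟩ := hK
  have e1 := hF (y + r)
  have e2 := hF (y + c • r)
  simp only [map_add, map_smul, LinearMap.add_apply, LinearMap.smul_apply, smul_eq_mul, hF] at e1 e2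
  have : c * (1 - c) * (F r y y + F y r y + F y y r) = 0 := by
    linear_combination e2 - c ^ 2 * e1
  simpa [h0, sub_eq_zero, Ne.symm h1] using this

theorem left_diag_eq_zero (P : VPair q F H ν μ) (hK : ∃ c : K, c ≠ 0 ∧ c ≠ 1)
    (hF : ∀ e, F e e e = 0) (y v : Fin 3 → K) : F y y v = 0 := by
  have hH := P.diag_eq_zero hF
  have pF := polar hF hK
  have pH := polar hH hK
  obtain ⟨hq, sF, sH, I, II, III⟩ := P
  have sF' (y x : Fin 3 → K) : F y x y = F y y x := by
    have := sF y x y; simpa [sub_eq_zero] using this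
  have sH' (y x : Fin 3 → K) : H y x y = H y y x := by
    have := sH y x y; simpa [sub_eq_zero] using this
  have key : ∀ w, F y y w ≠ 0 → H y y w = 0 := by
    intro w hw
    have aux (a : Fin 3 → K) : H y y a * F y a a = - F y y a * H a a y := by
      have h1 := I y a a y y a
      have h2 := pH y a
      have h3 := sH' a y
      simp only [hF, hH, sF', sH', vol_self₁, vol_self₂, mul_zero, zero_mul, add_zero] at h1 h2
      linear_combination h1 + F y y a * (h2 - h3)
    have a1 := aux w
    have a2 := aux (w + y)
    have b1 := pH w y
    simp only [map_add, LinearMap.add_apply, hF, hH, sF', sH'] at a2 b1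
    have : F y y w * H y y w = 0 := by linear_combination a2 - a1 - F y y w * b1
    simpa [hw] using this
  by_contra hv
  have hz (x : Fin 3 → K) : H y y x = 0 := by
    by_cases hx : F y y x = 0
    · have := key (x + v) (by simpa [hx] using hv)
      simpa [key v hv] using this
    · exact key x hx
  have hl (x w : Fin 3 → K) : H y x w = 0 := by
    have := II y x y v y w
    simp only [hH, sH', hz, vol_self₁, vol_self₂, mul_zero, zero_mul, add_zero, sub_zero] at this
    simpa [hv] using this
  have hr (r x : Fin 3 → K) : H r x y = 0 := by
    have := I y r x y y v
    simp only [hF, sF', sH', hz, hl, vol_self₁, vol_self₂, mul_zero, zero_mul, add_zero, sub_zero,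
      zero_sub, neg_eq_zero] at this
    simpa [hv] using this
  obtain ⟨u, fu, hu⟩ : ∃ u, F y y u = 0 ∧ vol y u v ≠ 0 := by
    obtain ⟨a, b, ha, hb, hab⟩ := exists_adapted (F y y) v hv
    by_contra! hc
    have h1 := hc a ha
    have h2 := hc b hb
    have h0 := cramer v a b y hab
    have h3 : vol v y b = 0 := by rw [← h2]; unfold vol; ring
    have h4 : vol v a y = 0 := by rw [← neg_eq_zero, ← h1]; unfold vol; ring
    rw [h3, h4, zero_smul, zero_smul, add_zero, add_zero] at h0
    have h5 : vol y a b * F y y v = 0 := by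
      have := hF y
      nth_rw 3 [h0] at this
      simpa using this
    have h6 : vol y a b = 0 := by simpa [hv] using h5
    rw [h6, zero_smul] at h0
    simp [h0] at hv
  have hx (r x : Fin 3 → K) : H r x u * F y y v = - q * vol x r y * vol y u v := by
    have := I y r x y u v
    simp only [hl, fu, vol_self₂, mul_zero, zero_mul, add_zero, sub_zero, zero_sub] at this
    linear_combination -this
  have ht : 1 + q = 0 := by
    have := sH v y u
    have h1 : vol v y u = vol y u v := by unfold vol; ring
    rw [hr, h1] at this
    have h2 := hx v y
    rw [vol_self₂, mul_zero, zero_mul] at h2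
    have h3 : H v y u = 0 := by simpa [hv] using h2
    rw [h3] at this
    simpa [hu] using this.symm
  have e1 := hx v u
  have e2 := hx u v
  have e3 := sH u v u
  have e4 := pH v u
  have h1 : vol u v y = vol y u v := by unfold vol; ring
  have h2 : vol v u y = - vol y u v := by unfold vol; ring
  rw [h1] at e1
  rw [h2] at e2
  rw [vol_self₂] at e3
  refine mul_ne_zero (mul_ne_zero hq hu) hu ?_
  linear_combination F y y v * e4 + F y y v * e3 - e1 - 2 * e2

theorem left_diag_eq_zero' (P : VPair q F H ν μ) (hK : ∃ c : K, c ≠ 0 ∧ c ≠ 1)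
    (hF : ∀ e, F e e e = 0) (y v : Fin 3 → K) : H y y v = 0 := by
  have hf := P.left_diag_eq_zero hK hF
  have hH := P.diag_eq_zero hF
  obtain ⟨hq, sF, sH, I, II, III⟩ := P
  have sF' (y x : Fin 3 → K) : F y x y = 0 := by
    have := sF y x y; simpa [sub_eq_zero, hf] using this
  have sH' (y x : Fin 3 → K) : H y x y = H y y x := by
    have := sH y x y; simpa [sub_eq_zero] using this
  by_contra hv
  have hl (r w : Fin 3 → K) : F y r w = 0 := by
    have := I y r v y y w
    simp only [hF, hf, sF', sH', vol_self₁, vol_self₂, mul_zero, zero_mul, add_zero, sub_zero]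
      at this
    simpa [hv] using this
  have hy : ∃ a b, vol y a b ≠ 0 := by
    by_contra! h0
    have := eq_zero_of_vol h0
    simp [this] at hv
  obtain ⟨a, b, hab⟩ := hy
  have := I y b a y a b
  have h1 : vol a b y = vol y a b := by unfold vol; ring
  simp only [hl, h1, vol_self₂, mul_zero, zero_mul, add_zero, sub_zero] at this
  exact mul_ne_zero (mul_ne_zero hq hab) hab this.symm

theorem eq_of_diag_eq_zero (P : VPair q F H ν μ) (hK : ∃ c : K, c ≠ 0 ∧ c ≠ 1)
    (hF : ∀ e, F e e e = 0) : F = H := by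
  have pF := polar hF hK
  have pH := polar (P.diag_eq_zero hF) hK
  have f1 := P.left_diag_eq_zero hK hF
  have h1 := P.left_diag_eq_zero' hK hF
  obtain ⟨hq, sF, sH, I, II, III⟩ := P
  have f2 (y x : Fin 3 → K) : F y x y = 0 := by
    have := sF y x y; simpa [sub_eq_zero, f1] using this
  have h2 (y x : Fin 3 → K) : H y x y = 0 := by
    have := sH y x y; simpa [sub_eq_zero, h1] using this
  have f3 (y x : Fin 3 → K) : F x y y = 0 := by simpa [f1, f2] using pF x y
  have h3 (y x : Fin 3 → K) : H x y y = 0 := by simpa [h1, h2] using pH x y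
  have fs (x y z : Fin 3 → K) : F y x z = - F x y z := by
    have := f1 (x + y) z
    simp only [map_add, LinearMap.add_apply, f1] at this
    linear_combination this
  have hs (x y z : Fin 3 → K) : H y x z = - H x y z := by
    have := h1 (x + y) z
    simp only [map_add, LinearMap.add_apply, h1] at this
    linear_combination this
  have ft (x y z : Fin 3 → K) : F x z y = - F x y z := by
    have := f3 (y + z) x
    simp only [map_add, LinearMap.add_apply, f3] at this
    linear_combination this
  have ht (x y z : Fin 3 → K) : H x z y = - H x y z := by
    have := h3 (y + z) x
    simp only [map_add, LinearMap.add_apply, h3] at this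
    linear_combination this
  obtain ⟨e, u, w, v0⟩ : ∃ e u w : Fin 3 → K, vol e u w = 1 :=
    ⟨Pi.single 0 1, Pi.single 1 1, Pi.single 2 1, by simp [vol]⟩
  have a1 := I e w u e u w
  have a2 := I u w e e u w
  have a3 := II w e u w e u
  have a4 := III e u w
  rw [cramer e u w (ν e) v0, cramer e u w (μ w) v0] at a4
  have v1 : vol u w e = 1 := by rw [← v0]; unfold vol; ring
  have v2 : vol w e u = 1 := by rw [← v0]; unfold vol; ring
  have v3 : vol e w u = -1 := by rw [← v0]; unfold vol; ring
  have v4 : vol (μ w) e u = vol e u (μ w) := by unfold vol; ring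
  simp only [map_add, map_smul, LinearMap.add_apply, LinearMap.smul_apply, smul_eq_mul,
    v0, v1, v2, v3, v4, f1, h1, f2, h2, f3, h3, fs e u w, hs e u w, ft e u w, ht e u w, hs e w u,
    ht w e u, vol_self₂, mul_zero, zero_mul, add_zero,
    sub_zero, zero_sub, zero_add] at a1 a2 a3 a4
  have key : F e u w = H e u w := by
    refine mul_left_cancel₀ hq ?_
    linear_combination a4 - F e u w * (2 * a1 + a2) + H e u w * (2 * a1 - a3)
  refine ext_adapted v0 (ext_adapted v0 ?_ ?_ ?_) (ext_adapted v0 ?_ ?_ ?_)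
    (ext_adapted v0 ?_ ?_ ?_) <;> refine ext_adapted v0 ?_ ?_ ?_
  all_goals clear I II III sF sH
  all_goals grind

theorem eq (P : VPair q F H ν μ) (hK : ∃ c : K, c ≠ 0 ∧ c ≠ 1) : F = H := by
  by_cases hF : ∀ e, F e e e = 0
  · exact P.eq_of_diag_eq_zero hK hF
  · push Not at hF
    obtain ⟨e, he⟩ := hF
    exact P.eq_of_ne e he

end VPair

section

/-- Coordinates of a pair of structure tensors. -/
structure VArr {k : Type*} [Field k] (q : k) (F H : Fin 3 → Fin 3 → Fin 3 → k)
    (ν μ : Fin 3 → Fin 3 → k) : Prop where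
  ne : q ≠ 0
  skewF : ∀ l i, F l (i + 1) (i + 2) - F l (i + 2) (i + 1) = if l = i then 1 + q else 0
  skewH : ∀ l i, H l (i + 1) (i + 2) - H l (i + 2) (i + 1) = if l = i then 1 + q else 0
  eqI : ∀ g x m i, H (g + 1) x (i + 1) * F m (g + 2) (i + 2)
    - H (g + 1) x (i + 2) * F m (g + 2) (i + 1) - H (g + 2) x (i + 1) * F m (g + 1) (i + 2)
    + H (g + 2) x (i + 2) * F m (g + 1) (i + 1)
      = -((if x = g then if m = i then q else 0 else 0) + if m = g then ν i x else 0)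
  eqII : ∀ l j z h, F (h + 1) (j + 2) z * H l (j + 1) (h + 2)
    - F (h + 2) (j + 2) z * H l (j + 1) (h + 1) - F (h + 1) (j + 1) z * H l (j + 2) (h + 2)
    + F (h + 2) (j + 1) z * H l (j + 2) (h + 1)
      = (if l = j then if z = h then q else 0 else 0) + if l = h then μ j z else 0
  eqIII : ∀ x y z, ∑ i, F i y z * ν i x = ∑ i, H i x y * μ i z

variable {K : Type*} [Field K]

theorem eq_zero_of_single {f : (Fin 3 → K) → K} (ha : ∀ x y, f (x + y) = f x + f y)
    (hs : ∀ (c : K) x, f (c • x) = c * f x) (hb : ∀ i, f (Pi.single i 1) = 0) (x : Fin 3 → K) :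
    f x = 0 := by
  have hx : x = x 0 • Pi.single 0 1 + x 1 • Pi.single 1 1 + x 2 • Pi.single 2 1 := by
    funext i; fin_cases i <;> simp
  rw [hx]; simp only [ha, hs, hb]; ring

theorem eq_zero_of_alternating {f : (Fin 3 → K) → (Fin 3 → K) → K}
    (ha : ∀ x y z, f (x + y) z = f x z + f y z) (hs : ∀ (c : K) x y, f (c • x) y = c * f x y)
    (hn : ∀ x y, f y x = - f x y) (hd : ∀ x, f x x = 0)
    (hb : ∀ i : Fin 3, f (Pi.single (i + 1) 1) (Pi.single (i + 2) 1) = 0) (x y : Fin 3 → K) :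
    f x y = 0 := by
  have hb' : ∀ i j : Fin 3, f (Pi.single i 1) (Pi.single j 1) = 0 := by
    intro i j
    have h : ∀ i j : Fin 3, i = j ∨ (∃ l : Fin 3, i = l + 1 ∧ j = l + 2) ∨
      ∃ l : Fin 3, j = l + 1 ∧ i = l + 2 := by decide
    rcases h i j with rfl | ⟨l, rfl, rfl⟩ | ⟨l, rfl, rfl⟩
    · exact hd _
    · exact hb l
    · rw [hn, hb, neg_zero]
  refine eq_zero_of_single (f := fun x => f x y) (fun a b => ha a b y) (fun c a => hs c a y)
    (fun i => ?_) x
  refine eq_zero_of_single (f := fun y => f (Pi.single i 1) y) (fun a b => ?_) (fun c a => ?_)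
    (hb' i) y
  · rw [hn, ha, hn _ (Pi.single i 1), hn _ (Pi.single i 1)]; ring
  · rw [hn, hs, hn _ (Pi.single i 1)]; ring

/-- The trilinear form with a given array of coefficients. -/
noncomputable def triForm (F : Fin 3 → Fin 3 → Fin 3 → K) :
    (Fin 3 → K) →ₗ[K] (Fin 3 → K) →ₗ[K] (Fin 3 → K) →ₗ[K] K :=
  (Pi.basisFun K (Fin 3)).constr K fun i => (Pi.basisFun K (Fin 3)).constr K fun j =>
    (Pi.basisFun K (Fin 3)).constr K fun l => F i j l

theorem triForm_single (F : Fin 3 → Fin 3 → Fin 3 → K) (i j l : Fin 3) :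
    triForm F (Pi.single i 1) (Pi.single j 1) (Pi.single l 1) = F i j l := by
  simp only [triForm, ← Pi.basisFun_apply K, Module.Basis.constr_basis]

theorem vol_single_right (x : Fin 3 → K) (i : Fin 3) :
    vol x (Pi.single (i + 1) 1) (Pi.single (i + 2) 1) = x i := by
  fin_cases i <;> simp [vol]

theorem vol_single_right' (x : Fin 3 → K) (i : Fin 3) :
    vol x (Pi.single (i + 2) 1) (Pi.single (i + 1) 1) = - x i := by
  rw [← vol_single_right x i]; unfold vol; ring

theorem triForm_sub_swap {t : K} {F : Fin 3 → Fin 3 → Fin 3 → K}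
    (h : ∀ l i, F l (i + 1) (i + 2) - F l (i + 2) (i + 1) = if l = i then t else 0)
    (x y z : Fin 3 → K) : triForm F x y z - triForm F x z y = t * vol x y z := by
  refine sub_eq_zero.1 (eq_zero_of_single (f := fun x => triForm F x y z - triForm F x z y -
    t * vol x y z) ?_ ?_ (fun l => ?_) x)
  · intros; simp [vol]; ring
  · intros; simp [vol]; ring
  refine eq_zero_of_alternating (f := fun y z => triForm F (Pi.single l 1) y z -
    triForm F (Pi.single l 1) z y - t * vol (Pi.single l 1) y z) ?_ ?_ ?_ ?_
    (fun i => ?_) y z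
  · intros; simp [vol]; ring
  · intros; simp [vol]; ring
  · intros; simp [vol]; ring
  · intros; simp only [vol]; ring
  · simp only [triForm_single, h, vol_single_right, Pi.single_apply, eq_comm (a := l)]
    split_ifs <;> ring

theorem VArr.vpair {q : K} {F H : Fin 3 → Fin 3 → Fin 3 → K} {ν μ : Fin 3 → Fin 3 → K}
    (P : VArr q F H ν μ) :
    VPair q (triForm F) (triForm H) (Matrix.toLin' (Matrix.of ν)) (Matrix.toLin' (Matrix.of μ))
      where
  ne := P.ne
  skewF := triForm_sub_swap P.skewF
  skewH := triForm_sub_swap P.skewH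
  eqI p r x y u v := by
    rw [← sub_eq_zero]
    generalize hN : Matrix.toLin' (Matrix.of ν) = N
    have hN' (x i : Fin 3) : N (Pi.single x 1) i = ν i x := by simp [← hN]
    clear hN
    refine eq_zero_of_alternating (f := fun p r => triForm H p x u * triForm F y r v
      - triForm H p x v * triForm F y r u - triForm H r x u * triForm F y p v
      + triForm H r x v * triForm F y p u - (q * vol x r p * vol y u v
      + vol y r p * vol (N x) u v)) ?_ ?_ ?_ ?_ (fun g => ?_) p r
    · intros; simp [vol]; ring
    · intros; simp [vol]; ring
    · intros; simp [vol]; ring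
    · intros; simp [vol]; ring
    simp only [vol_single_right']
    refine eq_zero_of_alternating (f := fun u v => triForm H (Pi.single (g + 1) 1) x u *
      triForm F y (Pi.single (g + 2) 1) v
      - triForm H (Pi.single (g + 1) 1) x v * triForm F y (Pi.single (g + 2) 1) u
      - triForm H (Pi.single (g + 2) 1) x u * triForm F y (Pi.single (g + 1) 1) v
      + triForm H (Pi.single (g + 2) 1) x v * triForm F y (Pi.single (g + 1) 1) u
      - (q * - x g * vol y u v + - y g * vol (N x) u v)) ?_ ?_ ?_ ?_ (fun i => ?_) u v
    · intros; simp [vol]; ring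
    · intros; simp [vol]; ring
    · intros; simp [vol]; ring
    · intros; simp [vol]; ring
    simp only [vol_single_right]
    refine eq_zero_of_single (f := fun x => triForm H (Pi.single (g + 1) 1) x (Pi.single (i + 1)
      1) *
      triForm F y (Pi.single (g + 2) 1) (Pi.single (i + 2) 1)
      - triForm H (Pi.single (g + 1) 1) x (Pi.single (i + 2) 1) *
        triForm F y (Pi.single (g + 2) 1) (Pi.single (i + 1) 1)
      - triForm H (Pi.single (g + 2) 1) x (Pi.single (i + 1) 1) *
        triForm F y (Pi.single (g + 1) 1) (Pi.single (i + 2) 1)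
      + triForm H (Pi.single (g + 2) 1) x (Pi.single (i + 2) 1) *
        triForm F y (Pi.single (g + 1) 1) (Pi.single (i + 1) 1)
      - (q * - x g * y i + - y g * N x i)) ?_ ?_ (fun x => ?_) x
    · intros; simp; ring
    · intros; simp; ring
    refine eq_zero_of_single (f := fun y =>
      triForm H (Pi.single (g + 1) 1) (Pi.single x 1) (Pi.single (i + 1) 1) *
      triForm F y (Pi.single (g + 2) 1) (Pi.single (i + 2) 1)
      - triForm H (Pi.single (g + 1) 1) (Pi.single x 1) (Pi.single (i + 2) 1) *
        triForm F y (Pi.single (g + 2) 1) (Pi.single (i + 1) 1)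
      - triForm H (Pi.single (g + 2) 1) (Pi.single x 1) (Pi.single (i + 1) 1) *
        triForm F y (Pi.single (g + 1) 1) (Pi.single (i + 2) 1)
      + triForm H (Pi.single (g + 2) 1) (Pi.single x 1) (Pi.single (i + 2) 1) *
        triForm F y (Pi.single (g + 1) 1) (Pi.single (i + 1) 1)
      - (q * - (Pi.single x 1 : Fin 3 → K) g * y i + - y g * N (Pi.single x 1) i)) ?_ ?_
      (fun m => ?_) y
    · intros; simp; ring
    · intros; simp; ring
    · simp only [triForm_single, P.eqI, hN', Pi.single_apply, eq_comm (a := m), eq_comm (a := x)]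
      split_ifs <;> ring
  eqII c x y z u v := by
    rw [← sub_eq_zero]
    generalize hN : Matrix.toLin' (Matrix.of μ) = N
    have hN' (x i : Fin 3) : N (Pi.single x 1) i = μ i x := by simp [← hN]
    clear hN
    refine eq_zero_of_alternating (f := fun x y => triForm F u y z * triForm H c x v
      - triForm F v y z * triForm H c x u - triForm F u x z * triForm H c y v
      + triForm F v x z * triForm H c y u
      - (q * vol c x y * vol z u v + vol (N z) x y * vol c u v)) ?_ ?_ ?_ ?_ (fun j => ?_) x y
    · intros; simp [vol]; ring
    · intros; simp [vol]; ring
    · intros; simp [vol]; ring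
    · intros; simp [vol]; ring
    simp only [vol_single_right]
    refine eq_zero_of_alternating (f := fun u v =>
      triForm F u (Pi.single (j + 2) 1) z * triForm H c (Pi.single (j + 1) 1) v
      - triForm F v (Pi.single (j + 2) 1) z * triForm H c (Pi.single (j + 1) 1) u
      - triForm F u (Pi.single (j + 1) 1) z * triForm H c (Pi.single (j + 2) 1) v
      + triForm F v (Pi.single (j + 1) 1) z * triForm H c (Pi.single (j + 2) 1) u
      - (q * c j * vol z u v + N z j * vol c u v)) ?_ ?_ ?_ ?_ (fun h => ?_) u v
    · intros; simp [vol]; ring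
    · intros; simp [vol]; ring
    · intros; simp [vol]; ring
    · intros; simp [vol]; ring
    simp only [vol_single_right]
    refine eq_zero_of_single (f := fun c =>
      triForm F (Pi.single (h + 1) 1) (Pi.single (j + 2) 1) z *
        triForm H c (Pi.single (j + 1) 1) (Pi.single (h + 2) 1)
      - triForm F (Pi.single (h + 2) 1) (Pi.single (j + 2) 1) z *
        triForm H c (Pi.single (j + 1) 1) (Pi.single (h + 1) 1)
      - triForm F (Pi.single (h + 1) 1) (Pi.single (j + 1) 1) z *
        triForm H c (Pi.single (j + 2) 1) (Pi.single (h + 2) 1)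
      + triForm F (Pi.single (h + 2) 1) (Pi.single (j + 1) 1) z *
        triForm H c (Pi.single (j + 2) 1) (Pi.single (h + 1) 1)
      - (q * c j * z h + N z j * c h)) ?_ ?_ (fun l => ?_) c
    · intros; simp; ring
    · intros; simp; ring
    refine eq_zero_of_single (f := fun z =>
      triForm F (Pi.single (h + 1) 1) (Pi.single (j + 2) 1) z *
        triForm H (Pi.single l 1) (Pi.single (j + 1) 1) (Pi.single (h + 2) 1)
      - triForm F (Pi.single (h + 2) 1) (Pi.single (j + 2) 1) z *
        triForm H (Pi.single l 1) (Pi.single (j + 1) 1) (Pi.single (h + 1) 1)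
      - triForm F (Pi.single (h + 1) 1) (Pi.single (j + 1) 1) z *
        triForm H (Pi.single l 1) (Pi.single (j + 2) 1) (Pi.single (h + 2) 1)
      + triForm F (Pi.single (h + 2) 1) (Pi.single (j + 1) 1) z *
        triForm H (Pi.single l 1) (Pi.single (j + 2) 1) (Pi.single (h + 1) 1)
      - (q * (Pi.single l 1 : Fin 3 → K) j * z h + N z j * (Pi.single l 1 : Fin 3 → K) h)) ?_ ?_
      (fun m => ?_) z
    · intros; simp; ring
    · intros; simp; ring
    · simp only [triForm_single, P.eqII, hN', Pi.single_apply, eq_comm (a := m), eq_comm (a := l)]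
      split_ifs <;> ring
  eqIII x y z := by
    rw [← sub_eq_zero]
    generalize hN : Matrix.toLin' (Matrix.of ν) = N
    have hN' (x : Fin 3) : N (Pi.single x 1) = ∑ i, ν i x • Pi.single i 1 := by
      ext i; simp [← hN, Finset.sum_apply, Pi.single_apply]
    generalize hM : Matrix.toLin' (Matrix.of μ) = M
    have hM' (x : Fin 3) : M (Pi.single x 1) = ∑ i, μ i x • Pi.single i 1 := by
      ext i; simp [← hM, Finset.sum_apply, Pi.single_apply]
    refine eq_zero_of_single (f := fun x => triForm F (N x) y z - triForm H (M z) x y)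
      ?_ ?_ (fun a => ?_) x
    · intros; simp; ring
    · intros; simp; ring
    refine eq_zero_of_single
      (f := fun y => triForm F (N (Pi.single a 1)) y z - triForm H (M z) (Pi.single a 1) y)
      ?_ ?_ (fun b => ?_) y
    · intros; simp; ring
    · intros; simp; ring
    refine eq_zero_of_single (f := fun z => triForm F (N (Pi.single a 1)) (Pi.single b 1) z
        - triForm H (M z) (Pi.single a 1) (Pi.single b 1)) ?_ ?_ (fun c => ?_) z
    · intros; simp; ring
    · intros; simp; ring
    · have := P.eqIII a b c
      simp only [hN', hM', map_sum, map_smul, LinearMap.sum_apply, LinearMap.smul_apply,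
        smul_eq_mul, triForm_single]
      simp only [mul_comm (ν _ _), mul_comm (μ _ _), this, sub_self]

theorem VArr.map {L : Type*} [Field L] (φ : K →+* L) {q : K} {F H : Fin 3 → Fin 3 → Fin 3 → K}
    {ν μ : Fin 3 → Fin 3 → K} (P : VArr q F H ν μ) :
    VArr (φ q) (fun i j l => φ (F i j l)) (fun i j l => φ (H i j l)) (fun i j => φ (ν i j))
      (fun i j => φ (μ i j)) where
  ne := by simpa using P.ne
  skewF l i := by simp only [← map_sub, P.skewF]; split_ifs <;> simp
  skewH l i := by simp only [← map_sub, P.skewH]; split_ifs <;> simp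
  eqI g x m i := by simp only [← map_sub, ← map_mul, ← map_add, P.eqI]; split_ifs <;> simp
  eqII l j z h := by simp only [← map_sub, ← map_mul, ← map_add, P.eqII]; split_ifs <;> simp
  eqIII x y z := by simp only [← map_mul, ← map_sum, P.eqIII]

theorem VArr.eq {q : K} {F H : Fin 3 → Fin 3 → Fin 3 → K} {ν μ : Fin 3 → Fin 3 → K}
    (P : VArr q F H ν μ) : F = H := by
  have hK : ∃ c : AlgebraicClosure K, c ≠ 0 ∧ c ≠ 1 := by
    classical
    obtain ⟨c, hc⟩ := Infinite.exists_notMem_finset ({0, 1} : Finset (AlgebraicClosure K))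
    exact ⟨c, by simpa using hc⟩
  have h := (P.map (algebraMap K (AlgebraicClosure K))).vpair.eq hK
  funext i j l
  apply (algebraMap K (AlgebraicClosure K)).injective
  have := congrArg (fun f => f (Pi.single i 1) (Pi.single j 1) (Pi.single l 1)) h
  simpa only [triForm_single] using this

theorem VArr.exists_of_braid {k : Type*} [Field k] {q : k} {F H : Fin 3 → Fin 3 → Fin 3 → k}
    {Λ : Fin 3 → Fin 3 → Fin 3 → k} (hq : q ≠ 0)
    (skewF : ∀ l i, F l (i + 1) (i + 2) - F l (i + 2) (i + 1) = if l = i then 1 + q else 0)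
    (skewH : ∀ l i, H l (i + 1) (i + 2) - H l (i + 2) (i + 1) = if l = i then 1 + q else 0)
    (surjF : ∀ j, ∃ ξ : Fin 3 → Fin 3 → k, ∀ i, ∑ y, ∑ z, ξ y z * F i y z = if i = j then 1 else 0)
    (surjH : ∀ j, ∃ ξ : Fin 3 → Fin 3 → k, ∀ i, ∑ y, ∑ z, ξ y z * H i y z = if i = j then 1 else 0)
    (hL : ∀ x y z l h, ∑ i, H i x y * (F (h + 1) (i + 2) z * H l (i + 1) (h + 2)
      - F (h + 2) (i + 2) z * H l (i + 1) (h + 1) - F (h + 1) (i + 1) z * H l (i + 2) (h + 2)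
      + F (h + 2) (i + 1) z * H l (i + 2) (h + 1) - if l = i then if z = h then q else 0 else 0)
      = if l = h then Λ x y z else 0)
    (hM : ∀ x y z g m, ∑ i, F i y z * -(H (g + 1) x (i + 1) * F m (g + 2) (i + 2)
      - H (g + 1) x (i + 2) * F m (g + 2) (i + 1) - H (g + 2) x (i + 1) * F m (g + 1) (i + 2)
      + H (g + 2) x (i + 2) * F m (g + 1) (i + 1) + if x = g then if m = i then q else 0 else 0)
      = if m = g then Λ x y z else 0) : ∃ ν μ, VArr q F H ν μ := by
  choose ξ hξ using surjF
  choose η hη using surjH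
  have inv {F : Fin 3 → Fin 3 → Fin 3 → k} {ξ : Fin 3 → Fin 3 → Fin 3 → k}
      (hξ : ∀ j i, ∑ y, ∑ z, ξ j y z * F i y z = if i = j then 1 else 0) (j : Fin 3)
      (A : Fin 3 → k) (B : Fin 3 → Fin 3 → k) (h : ∀ y z, ∑ i, F i y z * A i = B y z) :
      A j = ∑ y, ∑ z, ξ j y z * B y z := by
    have := hξ j
    simp only [← h, Finset.mul_sum]
    calc A j = ∑ i, (∑ y, ∑ z, ξ j y z * F i y z) * A i := by simp [hξ]
      _ = _ := by
        simp only [Finset.sum_mul, mul_assoc]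
        rw [Finset.sum_comm]
        exact Finset.sum_congr rfl fun _ _ => Finset.sum_comm
  have eI (g x m i) := inv hξ i _ _ fun y z => hM x y z g m
  have eII (l j z h) := inv hη j _ _ fun x y => hL x y z l h
  refine ⟨fun i x => ∑ y, ∑ z, ξ i y z * Λ x y z, fun j z => ∑ x, ∑ y, η j x y * Λ x y z,
    hq, skewF, skewH, fun g x m i => ?_, fun l j z h => ?_, fun x y z => ?_⟩
  · have := eI g x m i
    have h2 : (∑ y, ∑ z, ξ i y z * if m = g then Λ x y z else 0) =
      if m = g then ∑ y, ∑ z, ξ i y z * Λ x y z else 0 := by split_ifs <;> simp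
    rw [h2] at this
    linear_combination -this
  · have := eII l j z h
    have h2 : (∑ x, ∑ y, η j x y * if l = h then Λ x y z else 0) =
      if l = h then ∑ x, ∑ y, η j x y * Λ x y z else 0 := by split_ifs <;> simp
    rw [h2] at this
    linear_combination this
  · have h1 := hL x y z 0 0
    have h2 := hM x y z 0 0
    have e1 (j) := eII 0 j z 0
    have e2 (j) := eI 0 x 0 j
    simp only [if_true] at h1 h2 e1 e2
    simp only [← e1, ← e2]
    rw [h1, h2]

end

section

variable {k V}

/-- The basis `ζ(cᵢ) ⊗ cⱼ` of `V ⊗ V`. -/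
def twBasis (ζ : V ≃ₗ[k] V) (c : Module.Basis (Fin 3) k V) :
    Module.Basis (Fin 3 × Fin 3) k (V ⊗[k] V) :=
  (c.map ζ).tensorProduct c

theorem twBasis_apply (ζ : V ≃ₗ[k] V) (c : Module.Basis (Fin 3) k V) (i j : Fin 3) :
    twBasis ζ c (i, j) = ζ (c i) ⊗ₜ c j := by
  simp [twBasis]

theorem twBasis_ext {M : Type*} [AddCommGroup M] [Module k M] (ζ : V ≃ₗ[k] V)
    (c : Module.Basis (Fin 3) k V) {f g : V ⊗[k] V →ₗ[k] M}
    (h : ∀ i j, f (ζ (c i) ⊗ₜ c j) = g (ζ (c i) ⊗ₜ c j)) : f = g :=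
  (twBasis ζ c).ext fun ⟨i, j⟩ => by simpa [twBasis_apply] using h i j

theorem linearIndependent_wedge2 (ζ : V ≃ₗ[k] V) (c : Module.Basis (Fin 3) k V) :
    LinearIndependent k fun i : Fin 3 => wedge2 k V ζ (c (i + 1)) (c (i + 2)) := by
  rw [Fintype.linearIndependent_iff]
  intro g hg i
  have h := congrArg (fun t => (twBasis ζ c).repr t (i + 1, i + 2)) hg
  simp only [wedge2, ← twBasis_apply, Fin.sum_univ_three, map_add, map_smul, map_sub,
    Module.Basis.repr_self, Finsupp.add_apply, Finsupp.smul_apply, Finsupp.sub_apply,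
    Finsupp.single_apply, Prod.mk.injEq, map_zero, Finsupp.zero_apply] at h
  fin_cases i <;> simpa using h

theorem exists_sum_wedge2 (ζ : V ≃ₗ[k] V) (c : Module.Basis (Fin 3) k V) {t : V ⊗[k] V}
    (ht : t ∈ Ups2 k V ζ) :
    ∃ f : Fin 3 → k, t = ∑ i, f i • wedge2 k V ζ (c (i + 1)) (c (i + 2)) := by
  suffices h : Ups2 k V ζ ≤ Submodule.span k
      (Set.range fun i : Fin 3 => wedge2 k V ζ (c (i + 1)) (c (i + 2))) by
    obtain ⟨f, hf⟩ := (Submodule.mem_span_range_iff_exists_fun k).1 (h ht)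
    exact ⟨f, hf.symm⟩
  refine Submodule.span_le.2 ?_
  rintro _ ⟨x, y, rfl⟩
  refine (Submodule.mem_span_range_iff_exists_fun k).2
    ⟨fun i => c.repr x (i + 1) * c.repr y (i + 2) - c.repr x (i + 2) * c.repr y (i + 1), ?_⟩
  conv_rhs => rw [← c.sum_repr x, ← c.sum_repr y]
  simp only [wedge2, Fin.sum_univ_three, map_add, map_smul, TensorProduct.add_tmul,
    TensorProduct.tmul_add, ← TensorProduct.smul_tmul', TensorProduct.tmul_smul]
  simp only [Fin.isValue, Fin.reduceAdd, zero_add]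
  module

theorem wedge2_mem (ζ : V ≃ₗ[k] V) (x y : V) : wedge2 k V ζ x y ∈ Ups2 k V ζ :=
  Submodule.subset_span ⟨x, y, rfl⟩

/-- Structure constants of an operator with image `Υ²`. -/
theorem exists_structure_constants (ζ : V ≃ₗ[k] V) (c : Module.Basis (Fin 3) k V)
    {Y : V ⊗[k] V →ₗ[k] V ⊗[k] V} {t : k} (hY : LinearMap.range Y = Ups2 k V ζ)
    (hYY : Y ∘ₗ Y = t • Y) :
    ∃ F : Fin 3 → Fin 3 → Fin 3 → k,
      (∀ j l, Y (ζ (c j) ⊗ₜ c l) = ∑ i, F i j l • wedge2 k V ζ (c (i + 1)) (c (i + 2))) ∧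
      (∀ l i, F l (i + 1) (i + 2) - F l (i + 2) (i + 1) = if l = i then t else 0) ∧
      ∀ j, ∃ ξ : Fin 3 → Fin 3 → k, ∀ i, ∑ y, ∑ z, ξ y z * F i y z = if i = j then 1 else 0 := by
  have hmem (w : V ⊗[k] V) : Y w ∈ Ups2 k V ζ := hY ▸ LinearMap.mem_range_self Y w
  choose f hf using fun j l => exists_sum_wedge2 ζ c (hmem (ζ (c j) ⊗ₜ c l))
  have indep := linearIndependent_wedge2 ζ c
  have huniq {a b : Fin 3 → k} (h : ∑ i, a i • wedge2 k V ζ (c (i + 1)) (c (i + 2)) =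
      ∑ i, b i • wedge2 k V ζ (c (i + 1)) (c (i + 2))) (i : Fin 3) : a i = b i := by
    have := (Fintype.linearIndependent_iff.1 indep) (a - b)
      (by simp only [Pi.sub_apply, sub_smul, Finset.sum_sub_distrib, h, sub_self]) i
    simpa [sub_eq_zero] using this
  have hrange (i : Fin 3) : ∃ w, Y w = wedge2 k V ζ (c (i + 1)) (c (i + 2)) :=
    LinearMap.mem_range.1 (hY ▸ wedge2_mem ζ _ _)
  refine ⟨fun i j l => f j l i, hf, fun l i => ?_, fun j => ?_⟩
  · obtain ⟨w, hw⟩ := hrange i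
    have h1 : Y (wedge2 k V ζ (c (i + 1)) (c (i + 2))) =
        t • wedge2 k V ζ (c (i + 1)) (c (i + 2)) := by
      rw [← hw]; exact LinearMap.congr_fun hYY w
    have h2 : ∑ l, (f (i + 1) (i + 2) l - f (i + 2) (i + 1) l) •
        wedge2 k V ζ (c (l + 1)) (c (l + 2)) =
        ∑ l, (if l = i then t else 0) • wedge2 k V ζ (c (l + 1)) (c (l + 2)) := by
      simp only [sub_smul, Finset.sum_sub_distrib, ← hf, ite_smul, zero_smul, Finset.sum_ite_eq',
        Finset.mem_univ, if_true]
      rw [← h1, wedge2, map_sub]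
    exact huniq h2 l
  · obtain ⟨w, hw⟩ := hrange j
    refine ⟨fun y z => (twBasis ζ c).repr w (y, z), fun i => ?_⟩
    rw [← (twBasis ζ c).sum_repr w] at hw
    simp only [map_sum, map_smul, Fintype.sum_prod_type, twBasis_apply, hf] at hw
    refine huniq (a := fun i => ∑ y, ∑ z, (twBasis ζ c).repr w (y, z) * f y z i)
      (b := fun i => if i = j then 1 else 0) ?_ i
    simp only [ite_smul, one_smul, zero_smul, Finset.sum_ite_eq', Finset.mem_univ, if_true]
    rw [← hw]
    simp only [Finset.sum_smul, Finset.smul_sum, mul_smul]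
    rw [Finset.sum_comm]
    exact Finset.sum_congr rfl fun _ _ => Finset.sum_comm

/-- The basis `ζ²(bᵢ) ⊗ ζ(bⱼ) ⊗ bₗ` of `V ⊗ V ⊗ V`. -/
def twBasis₃ (ζ : V ≃ₗ[k] V) (b : Module.Basis (Fin 3) k V) :
    Module.Basis (Fin 3 × Fin 3 × Fin 3) k (V ⊗[k] (V ⊗[k] V)) :=
  ((b.map ζ).map ζ).tensorProduct (twBasis ζ b)

theorem twBasis₃_apply (ζ : V ≃ₗ[k] V) (b : Module.Basis (Fin 3) k V) (x y z : Fin 3) :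
    twBasis₃ ζ b (x, y, z) = ζ (ζ (b x)) ⊗ₜ (ζ (b y) ⊗ₜ b z) := by
  simp [twBasis₃, twBasis_apply]

/-- A tensor that is skew in the first two and in the last two arguments is totally skew. -/
theorem exists_alternating_coeff {M : Type*} [AddCommGroup M] [Module k M]
    (β : Module.Basis (Fin 3 × Fin 3 × Fin 3) k M) {L N : Fin 3 → Fin 3 → k}
    (h : ∑ l, ∑ h, L l h • (β (l + 1, l + 2, h) - β (l + 2, l + 1, h)) =
      ∑ g, ∑ m, N g m • (β (g, m + 1, m + 2) - β (g, m + 2, m + 1))) :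
    ∃ Λ, (∀ l h, L l h = if l = h then Λ else 0) ∧ ∀ g m, N g m = if m = g then Λ else 0 := by
  have key (x y z : Fin 3) := congrArg (fun t => β.repr t (x, y, z)) h
  simp only [Fin.sum_univ_three, map_add, map_smul, map_sub,
    Module.Basis.repr_self, Finsupp.add_apply, Finsupp.smul_apply, Finsupp.sub_apply,
    Finsupp.single_apply, Prod.mk.injEq] at key
  have k001 := key 0 0 1
  have k002 := key 0 0 2
  have k110 := key 1 1 0
  have k112 := key 1 1 2
  have k220 := key 2 2 0
  have k221 := key 2 2 1
  have k100 := key 1 0 0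
  have k200 := key 2 0 0
  have k011 := key 0 1 1
  have k211 := key 2 1 1
  have k022 := key 0 2 2
  have k122 := key 1 2 2
  have k012 := key 0 1 2
  have k120 := key 1 2 0
  have k201 := key 2 0 1
  have k102 := key 1 0 2
  have k021 := key 0 2 1
  clear key
  simp at k001 k002 k110 k112 k220 k221 k100 k200 k011 k211 k022 k122 k012 k120 k201 k102 k021
  refine ⟨L 0 0, fun l h => ?_, fun g m => ?_⟩
  · fin_cases l <;> fin_cases h <;> simp <;> grind
  · fin_cases g <;> fin_cases m <;> simp <;> grind

theorem op12_sub_smul (q : k) (Y : V ⊗[k] V →ₗ[k] V ⊗[k] V) :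
    op12 k V (q • LinearMap.id - Y) = q • LinearMap.id - op12 k V Y := by
  ext x y z; simp [op12, TensorProduct.smul_tmul']

theorem op23_sub_smul (q : k) (Y : V ⊗[k] V →ₗ[k] V ⊗[k] V) :
    op23 k V (q • LinearMap.id - Y) = q • LinearMap.id - op23 k V Y := by
  ext x y z; simp [op23]

theorem op12_comp (Y Z : V ⊗[k] V →ₗ[k] V ⊗[k] V) :
    op12 k V (Y ∘ₗ Z) = op12 k V Y ∘ₗ op12 k V Z := by
  ext x y z; simp [op12]

theorem op23_comp (Y Z : V ⊗[k] V →ₗ[k] V ⊗[k] V) :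
    op23 k V (Y ∘ₗ Z) = op23 k V Y ∘ₗ op23 k V Z := by
  ext x y z; simp [op23]

theorem op12_smul (t : k) (Y : V ⊗[k] V →ₗ[k] V ⊗[k] V) : op12 k V (t • Y) = t • op12 k V Y := by
  ext x y z; simp [op12]

theorem op23_smul (t : k) (Y : V ⊗[k] V →ₗ[k] V ⊗[k] V) : op23 k V (t • Y) = t • op23 k V Y := by
  ext x y z; simp [op23]

theorem skewY_comp_self {q : k} {R : V ⊗[k] V →ₗ[k] V ⊗[k] V} (hR : IsHeckeSymmetry k V q R) :
    skewY k V q R ∘ₗ skewY k V q R = (1 + q) • skewY k V q R := by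
  have h := hR.2.2
  rw [← sub_eq_zero, ← h]
  simp only [skewY, LinearMap.sub_comp, LinearMap.comp_sub, LinearMap.comp_add,
    LinearMap.smul_comp, LinearMap.comp_smul, LinearMap.id_comp, LinearMap.comp_id]
  module

theorem braid_of_braid_sub_smul {M : Type*} [AddCommGroup M] [Module k M] {q : k}
    {a b : M →ₗ[k] M} (ha : a ∘ₗ a = (1 + q) • a) (hb : b ∘ₗ b = (1 + q) • b)
    (h : (q • LinearMap.id - a) ∘ₗ (q • LinearMap.id - b) ∘ₗ (q • LinearMap.id - a) =
      (q • LinearMap.id - b) ∘ₗ (q • LinearMap.id - a) ∘ₗ (q • LinearMap.id - b)) :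
    a ∘ₗ b ∘ₗ a - q • a = b ∘ₗ a ∘ₗ b - q • b := by
  simp only [LinearMap.sub_comp, LinearMap.comp_sub, LinearMap.smul_comp, LinearMap.comp_smul,
    LinearMap.id_comp, LinearMap.comp_id, ha, hb] at h
  rw [← sub_eq_zero] at h ⊢
  rw [← neg_eq_zero, ← h]
  module

theorem skewY_braid {q : k} {R : V ⊗[k] V →ₗ[k] V ⊗[k] V} (hR : IsHeckeSymmetry k V q R) :
    op12 k V (skewY k V q R) ∘ₗ op23 k V (skewY k V q R) ∘ₗ op12 k V (skewY k V q R)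
      - q • op12 k V (skewY k V q R) =
    op23 k V (skewY k V q R) ∘ₗ op12 k V (skewY k V q R) ∘ₗ op23 k V (skewY k V q R)
      - q • op23 k V (skewY k V q R) := by
  have hYY := skewY_comp_self hR
  have h12 := congrArg (op12 k V) hYY
  have h23 := congrArg (op23 k V) hYY
  rw [op12_comp, op12_smul] at h12
  rw [op23_comp, op23_smul] at h23
  have hb := hR.2.1
  have hRY : R = q • LinearMap.id - skewY k V q R := by simp [skewY]
  have h1 := op12_sub_smul q (skewY k V q R)
  have h2 := op23_sub_smul q (skewY k V q R)
  rw [← hRY] at h1 h2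
  rw [h1, h2] at hb
  exact braid_of_braid_sub_smul h12 h23 hb

theorem map_wedge2 (ζ : V ≃ₗ[k] V) (x y : V) :
    TensorProduct.map ζ.toLinearMap ζ.toLinearMap (wedge2 k V ζ x y) = wedge2 k V ζ (ζ x) (ζ y)
      := by
  simp [wedge2]

theorem op12_twBasis₃ (ζ : V ≃ₗ[k] V) (b : Module.Basis (Fin 3) k V)
    {Y : V ⊗[k] V →ₗ[k] V ⊗[k] V} {H : Fin 3 → Fin 3 → Fin 3 → k}
    (hH : ∀ j l, Y (ζ (ζ (b j)) ⊗ₜ ζ (b l)) =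
      ∑ i, H i j l • wedge2 k V ζ (ζ (b (i + 1))) (ζ (b (i + 2)))) (x y z : Fin 3) :
    op12 k V Y (twBasis₃ ζ b (x, y, z)) =
      ∑ i, H i x y • (twBasis₃ ζ b (i + 1, i + 2, z) - twBasis₃ ζ b (i + 2, i + 1, z)) := by
  simp only [twBasis₃_apply, op12, LinearMap.comp_apply, LinearEquiv.coe_coe,
    TensorProduct.assoc_symm_tmul, LinearMap.rTensor_tmul, hH, wedge2, TensorProduct.sum_tmul,
    ← TensorProduct.smul_tmul', TensorProduct.sub_tmul, map_sum, map_smul, map_sub,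
    TensorProduct.assoc_tmul]

theorem op23_twBasis₃ (ζ : V ≃ₗ[k] V) (b : Module.Basis (Fin 3) k V)
    {Y : V ⊗[k] V →ₗ[k] V ⊗[k] V} {F : Fin 3 → Fin 3 → Fin 3 → k}
    (hF : ∀ j l, Y (ζ (b j) ⊗ₜ b l) =
      ∑ i, F i j l • wedge2 k V ζ (b (i + 1)) (b (i + 2))) (x y z : Fin 3) :
    op23 k V Y (twBasis₃ ζ b (x, y, z)) =
      ∑ i, F i y z • (twBasis₃ ζ b (x, i + 1, i + 2) - twBasis₃ ζ b (x, i + 2, i + 1)) := by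
  simp only [twBasis₃_apply, op23, LinearMap.lTensor_tmul, hF, wedge2, TensorProduct.tmul_sum,
    TensorProduct.tmul_smul, TensorProduct.tmul_sub]

theorem exists_coeff_of_braid {M : Type*} [AddCommGroup M] [Module k M]
    (β : Module.Basis (Fin 3 × Fin 3 × Fin 3) k M) {q : k} {a b : M →ₗ[k] M}
    {F H : Fin 3 → Fin 3 → Fin 3 → k}
    (ha : ∀ x y z, a (β (x, y, z)) = ∑ i, H i x y • (β (i + 1, i + 2, z) - β (i + 2, i + 1, z)))
    (hb : ∀ x y z, b (β (x, y, z)) = ∑ i, F i y z • (β (x, i + 1, i + 2) - β (x, i + 2, i + 1)))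
    (h : a ∘ₗ b ∘ₗ a - q • a = b ∘ₗ a ∘ₗ b - q • b) (x y z : Fin 3) :
    ∃ Λ, (∀ l h, ∑ i, H i x y * (F (h + 1) (i + 2) z * H l (i + 1) (h + 2)
      - F (h + 2) (i + 2) z * H l (i + 1) (h + 1) - F (h + 1) (i + 1) z * H l (i + 2) (h + 2)
      + F (h + 2) (i + 1) z * H l (i + 2) (h + 1) - if l = i then if z = h then q else 0 else 0)
      = if l = h then Λ else 0) ∧
    (∀ g m, ∑ i, F i y z * -(H (g + 1) x (i + 1) * F m (g + 2) (i + 2)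
      - H (g + 1) x (i + 2) * F m (g + 2) (i + 1) - H (g + 2) x (i + 1) * F m (g + 1) (i + 2)
      + H (g + 2) x (i + 2) * F m (g + 1) (i + 1) + if x = g then if m = i then q else 0 else 0)
      = if m = g then Λ else 0) := by
  refine exists_alternating_coeff β ?_
  have e1 (i : Fin 3) : a (b (β (i + 1, i + 2, z) - β (i + 2, i + 1, z)))
      - q • (β (i + 1, i + 2, z) - β (i + 2, i + 1, z)) =
      ∑ l, ∑ h, (F (h + 1) (i + 2) z * H l (i + 1) (h + 2)
      - F (h + 2) (i + 2) z * H l (i + 1) (h + 1) - F (h + 1) (i + 1) z * H l (i + 2) (h + 2)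
      + F (h + 2) (i + 1) z * H l (i + 2) (h + 1) - if l = i then if z = h then q else 0 else 0) •
      (β (l + 1, l + 2, h) - β (l + 2, l + 1, h)) := by
    have e0 : q • (β (i + 1, i + 2, z) - β (i + 2, i + 1, z)) =
        ∑ l, ∑ h, (if l = i then if z = h then q else 0 else 0) •
        (β (l + 1, l + 2, h) - β (l + 2, l + 1, h)) := by
      simp [ite_smul, zero_smul]
    rw [e0]
    simp only [sub_smul _ (ite _ _ _), Finset.sum_sub_distrib]
    congr 1
    simp only [map_sub, map_add, hb, map_smul, ha, Fin.sum_univ_three]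
    simp only [Fin.isValue, Fin.reduceAdd, zero_add]
    module
  have e2 (i : Fin 3) : b (a (β (x, i + 1, i + 2) - β (x, i + 2, i + 1)))
      - q • (β (x, i + 1, i + 2) - β (x, i + 2, i + 1)) =
      ∑ g, ∑ m, (-(H (g + 1) x (i + 1) * F m (g + 2) (i + 2)
      - H (g + 1) x (i + 2) * F m (g + 2) (i + 1) - H (g + 2) x (i + 1) * F m (g + 1) (i + 2)
      + H (g + 2) x (i + 2) * F m (g + 1) (i + 1) + if x = g then if m = i then q else 0 else 0)) •
      (β (g, m + 1, m + 2) - β (g, m + 2, m + 1)) := by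
    have e0 : q • (β (x, i + 1, i + 2) - β (x, i + 2, i + 1)) =
        ∑ g, ∑ m, (if x = g then if m = i then q else 0 else 0) •
        (β (g, m + 1, m + 2) - β (g, m + 2, m + 1)) := by
      rw [Finset.sum_eq_single x, Finset.sum_eq_single i] <;> simp +contextual [eq_comm]
    rw [e0]
    simp only [neg_add _ (ite _ _ _), ← sub_eq_add_neg, sub_smul _ (ite _ _ _),
      Finset.sum_sub_distrib]
    congr 1
    simp only [map_sub, map_add, hb, map_smul, ha, Fin.sum_univ_three]
    simp only [Fin.isValue, Fin.reduceAdd, zero_add]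
    module
  have h := LinearMap.congr_fun h (β (x, y, z))
  simp only [LinearMap.sub_apply, LinearMap.comp_apply, LinearMap.smul_apply, ha x y z, hb x y z,
    map_sum, map_smul] at h
  have h3 : ∑ i, H i x y • (a (b (β (i + 1, i + 2, z) - β (i + 2, i + 1, z)))
      - q • (β (i + 1, i + 2, z) - β (i + 2, i + 1, z))) =
    ∑ i, F i y z • (b (a (β (x, i + 1, i + 2) - β (x, i + 2, i + 1)))
      - q • (β (x, i + 1, i + 2) - β (x, i + 2, i + 1))) := by
    simpa only [smul_sub, Finset.sum_sub_distrib, Finset.smul_sum, smul_comm q] using h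
  simp only [e1, e2, Finset.smul_sum, smul_smul] at h3
  simp only [Finset.sum_smul]
  exact (((Finset.sum_congr rfl fun _ _ => Finset.sum_comm).trans Finset.sum_comm).trans h3).trans
    ((Finset.sum_congr rfl fun _ _ => Finset.sum_comm).trans Finset.sum_comm).symm

theorem comp_map_comm (hdim : Module.finrank k V = 3) (ζ : V ≃ₗ[k] V) {q : k}
    {R : V ⊗[k] V →ₗ[k] V ⊗[k] V} (hR : IsHeckeSymmetry k V q R)
    (hY : LinearMap.range (skewY k V q R) = Ups2 k V ζ) :
    TensorProduct.map ζ.toLinearMap ζ.toLinearMap ∘ₗ R =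
      R ∘ₗ TensorProduct.map ζ.toLinearMap ζ.toLinearMap := by
  have : Module.Finite k V := Module.finite_of_finrank_pos (by omega)
  let b : Module.Basis (Fin 3) k V := Module.finBasisOfFinrankEq k V hdim
  have hYY := skewY_comp_self hR
  obtain ⟨F, hF, skewF, surjF⟩ := exists_structure_constants ζ b hY hYY
  obtain ⟨H, hH, skewH, surjH⟩ := exists_structure_constants ζ (b.map ζ) hY hYY
  simp only [Module.Basis.map_apply] at hH
  choose Λ hL hM using exists_coeff_of_braid (twBasis₃ ζ b) (op12_twBasis₃ ζ b hH)
    (op23_twBasis₃ ζ b hF) (skewY_braid hR)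
  obtain ⟨ν, μ, P⟩ := VArr.exists_of_braid hR.1 skewF skewH surjF surjH hL hM
  obtain rfl := P.eq
  have hc : TensorProduct.map ζ.toLinearMap ζ.toLinearMap ∘ₗ skewY k V q R =
      skewY k V q R ∘ₗ TensorProduct.map ζ.toLinearMap ζ.toLinearMap := by
    refine twBasis_ext ζ b fun i j => ?_
    simp only [LinearMap.comp_apply, hF, map_sum, map_smul, map_wedge2, TensorProduct.map_tmul,
      LinearEquiv.coe_coe, hH]
  have hRY : R = q • LinearMap.id - skewY k V q R := by simp [skewY]
  rw [hRY, LinearMap.comp_sub, LinearMap.sub_comp, hc, LinearMap.comp_smul, LinearMap.smul_comp,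
    LinearMap.id_comp, LinearMap.comp_id]

end

end TwistedHecke

theorem stmt6 (hdim : Module.finrank k V = 3) (ζ : V ≃ₗ[k] V) (q : k)
    (R : V ⊗[k] V →ₗ[k] V ⊗[k] V) (hR : IsHeckeSymmetry k V q R)
    (hY : LinearMap.range (skewY k V q R) = Ups2 k V ζ) :
    (TensorProduct.map ζ.toLinearMap ζ.toLinearMap ∘ₗ
        TensorProduct.map ζ.toLinearMap ζ.toLinearMap ∘ₗ
        TensorProduct.map ζ.toLinearMap ζ.toLinearMap) ∘ₗ R =
      R ∘ₗ (TensorProduct.map ζ.toLinearMap ζ.toLinearMap ∘ₗ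
        TensorProduct.map ζ.toLinearMap ζ.toLinearMap ∘ₗ
        TensorProduct.map ζ.toLinearMap ζ.toLinearMap) := by
  have h := TwistedHecke.comp_map_comm hdim ζ hR hY
  rw [LinearMap.comp_assoc, LinearMap.comp_assoc, h, ← LinearMap.comp_assoc _ R, h,
    LinearMap.comp_assoc, ← LinearMap.comp_assoc _ R, h, LinearMap.comp_assoc]
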